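/- For every integer n ≥ 3, the closed unit ball B⁴ = {x ∈ ℝ⁴ : ‖x‖ ≤ 1} admits a monohedral tiling by n tiles, each of which is homeomorphic (with its subspace topology) to the product (S¹ × S¹) × D², where S¹ = {v ∈ ℝ² : ‖v‖ = 1} is the unit circle and D² = {v ∈ ℝ² : ‖v‖ ≤ 1} is the closed unit disk. (This is the 4D Tiling Theorem of the paper in the case where the surface F is a torus, recorded up to the homeomorphism type of the tiles: each tile is a neighborhood of an embedded torus and hence homeomorphic to T² × D².) -/

import Mathlib

open Set

/-- A positively homogeneous function that is positive away from the origin. -/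
structure IsStarGauge {V : Type*} [AddCommGroup V] [Module ℝ V] (N : V → ℝ) : Prop where
  smul : ∀ (t : ℝ) (w : V), 0 ≤ t → N (t • w) = t * N w
  pos : ∀ w : V, w ≠ 0 → 0 < N w

/-- The map rescaling every ray from the origin so that the gauge `γ` of the image of a vector is
the gauge `N` of the vector. -/
noncomputable def radialRescale {V : Type*} [AddCommGroup V] [Module ℝ V] (N γ : V → ℝ) (w : V) :
    V :=
  (N w / γ w) • w

namespace IsStarGauge

variable {V : Type*} [AddCommGroup V] [Module ℝ V] {N γ : V → ℝ}

theorem map_zero (hN : IsStarGauge N) : N 0 = 0 := by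
  simpa using hN.smul 0 0 le_rfl

theorem nonneg (hN : IsStarGauge N) (w : V) : 0 ≤ N w := by
  rcases eq_or_ne w 0 with rfl | h
  · exact hN.map_zero.ge
  · exact (hN.pos w h).le

theorem div_nonneg (hN : IsStarGauge N) (hγ : IsStarGauge γ) (w : V) : 0 ≤ N w / γ w :=
  _root_.div_nonneg (hN.nonneg w) (hγ.nonneg w)

theorem gauge_radialRescale (hN : IsStarGauge N) (hγ : IsStarGauge γ) (w : V) :
    γ (radialRescale N γ w) = N w := by
  rcases eq_or_ne w 0 with rfl | h
  · simp [radialRescale, hN.map_zero, hγ.map_zero]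
  · rw [radialRescale, hγ.smul _ _ (hN.div_nonneg hγ w), div_mul_cancel₀ _ (hγ.pos w h).ne']

theorem radialRescale_radialRescale (hN : IsStarGauge N) (hγ : IsStarGauge γ) (w : V) :
    radialRescale γ N (radialRescale N γ w) = w := by
  rcases eq_or_ne w 0 with rfl | h
  · simp [radialRescale]
  · have h1 := (hγ.pos w h).ne'
    have h2 := (hN.pos w h).ne'
    rw [radialRescale, hN.gauge_radialRescale hγ, radialRescale,
      hN.smul _ _ (hN.div_nonneg hγ w), smul_smul]
    convert one_smul ℝ w
    field_simp

theorem radialRescale_injective (hN : IsStarGauge N) (hγ : IsStarGauge γ) :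
    Function.Injective (radialRescale N γ) :=
  Function.LeftInverse.injective (hN.radialRescale_radialRescale hγ)

theorem norm {V : Type*} [NormedAddCommGroup V] [NormedSpace ℝ V] :
    IsStarGauge (fun w : V => ‖w‖) where
  smul t w ht := by rw [norm_smul, Real.norm_of_nonneg ht]
  pos w hw := norm_pos_iff.2 hw

end IsStarGauge

theorem continuous_radialRescale {B V : Type*} [TopologicalSpace B] [CompactSpace B]
    [NormedAddCommGroup V] [NormedSpace ℝ V] [ProperSpace V] {N γ : B → V → ℝ}
    (hN : ∀ x, IsStarGauge (N x)) (hγ : ∀ x, IsStarGauge (γ x))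
    (hNc : Continuous fun p : B × V => N p.1 p.2) (hγc : Continuous fun p : B × V => γ p.1 p.2) :
    Continuous fun p : B × V => radialRescale (N p.1) (γ p.1) p.2 := by
  have key : ∀ w : V, w ≠ 0 → ∀ x, ContinuousAt (fun p : B × V => N p.1 p.2 / γ p.1 p.2) (x, w) :=
    fun w hw x => hNc.continuousAt.div hγc.continuousAt ((hγ x).pos w hw).ne'
  obtain ⟨C, hC⟩ : ∃ C, ∀ p ∈ (univ : Set B) ×ˢ Metric.sphere (0 : V) 1,
      N p.1 p.2 / γ p.1 p.2 ≤ C := by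
    have hK : IsCompact ((univ : Set B) ×ˢ Metric.sphere (0 : V) 1) :=
      isCompact_univ.prod (isCompact_sphere _ _)
    obtain ⟨C, hC⟩ := hK.bddAbove_image (f := fun p : B × V => N p.1 p.2 / γ p.1 p.2) (by
      rintro ⟨x, w⟩ ⟨-, hw⟩
      exact (key w (by rintro rfl; simp at hw) x).continuousWithinAt)
    exact ⟨C, fun p hp => hC ⟨p, hp, rfl⟩⟩
  have hbound : ∀ p : B × V, ‖radialRescale (N p.1) (γ p.1) p.2‖ ≤ C * ‖p.2‖ := by
    rintro ⟨x, w⟩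
    rcases eq_or_ne w 0 with rfl | hw
    · simp [radialRescale]
    · have h0 : ‖w‖ ≠ 0 := norm_ne_zero_iff.2 hw
      have h1 : w = ‖w‖ • (‖w‖⁻¹ • w) := by rw [smul_smul, mul_inv_cancel₀ h0, one_smul]
      have h2 := hC (x, ‖w‖⁻¹ • w) ⟨trivial, by simp [norm_smul, h0]⟩
      have h3 : N x w / γ x w = N x (‖w‖⁻¹ • w) / γ x (‖w‖⁻¹ • w) := by
        rw [(hN x).smul _ _ (by positivity), (hγ x).smul _ _ (by positivity)]
        rw [mul_div_mul_left _ _ (inv_ne_zero h0)]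
      simp only [radialRescale, norm_smul]
      rw [Real.norm_of_nonneg ((hN x).div_nonneg (hγ x) w), h3]
      gcongr
  rw [continuous_iff_continuousAt]
  rintro ⟨x, w⟩
  rcases eq_or_ne w 0 with rfl | hw
  · have : Filter.Tendsto (fun p : B × V => C * ‖p.2‖) (nhds (x, 0)) (nhds 0) := by
      have h : Continuous fun p : B × V => C * ‖p.2‖ := by fun_prop
      simpa using h.tendsto (x, 0)
    simpa [ContinuousAt, radialRescale] using squeeze_zero_norm hbound this
  · exact (key w hw x).smul continuousAt_snd

/-- The gauge, about `(3/32, 3/4)`, of the cross section of the solid `torusSolid` at the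
angles `ω` and `η`. -/
noncomputable def sectionGauge (ω η w : EuclideanSpace ℝ (Fin 2)) : ℝ :=
  max (max (max (w 1 / (1 / 4)) (-w 1 / (3 / 4)))
    (max ((-16 * w 0 - w 1) / (1 / 4)) ((-16 * (w 0 * η 0) - w 1) / (11 / 4 + 3 / 2 * η 0))))
  (max (max (max (w 0 * η 0 * ω 0 / (1 - (1 / 4 + 3 / 32 * η 0) * ω 0))
      (-(w 0 * η 0 * ω 0) / (1 + (1 / 4 + 3 / 32 * η 0) * ω 0)))
    (max (w 0 * η 0 * ω 1 / (1 / 2 - (1 / 4 + 3 / 32 * η 0) * ω 1))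
      (-(w 0 * η 0 * ω 1) / (3 / 2 + (1 / 4 + 3 / 32 * η 0) * ω 1))))
    (max (w 0 * η 1 / (1 - 3 / 32 * η 1)) (-(w 0 * η 1) / (1 + 3 / 32 * η 1))))

theorem sphere_two_sq {ω : EuclideanSpace ℝ (Fin 2)} (h : ω ∈ Metric.sphere 0 1) :
    ω 0 ^ 2 + ω 1 ^ 2 = 1 := by
  have h1 := EuclideanSpace.norm_sq_eq ω
  rw [mem_sphere_zero_iff_norm.1 h] at h1
  simpa [Fin.sum_univ_two] using h1.symm

theorem sphere_two_abs_le {ω : EuclideanSpace ℝ (Fin 2)} (h : ω ∈ Metric.sphere 0 1) :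
    (-1 ≤ ω 0 ∧ ω 0 ≤ 1) ∧ -1 ≤ ω 1 ∧ ω 1 ≤ 1 := by
  have := sphere_two_sq h
  refine ⟨⟨?_, ?_⟩, ?_, ?_⟩ <;> nlinarith

theorem sectionGauge_slack_pos {ω η : EuclideanSpace ℝ (Fin 2)} (hω : ω ∈ Metric.sphere 0 1)
    (hη : η ∈ Metric.sphere 0 1) :
    0 < 11 / 4 + 3 / 2 * η 0 ∧ 0 < 1 - (1 / 4 + 3 / 32 * η 0) * ω 0 ∧
    0 < 1 + (1 / 4 + 3 / 32 * η 0) * ω 0 ∧ 0 < 1 / 2 - (1 / 4 + 3 / 32 * η 0) * ω 1 ∧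
    0 < 3 / 2 + (1 / 4 + 3 / 32 * η 0) * ω 1 ∧ 0 < 1 - 3 / 32 * η 1 ∧
    0 < 1 + 3 / 32 * η 1 := by
  obtain ⟨⟨h1, h2⟩, h3, h4⟩ := sphere_two_abs_le hω
  obtain ⟨⟨h5, h6⟩, h7, h8⟩ := sphere_two_abs_le hη
  refine ⟨?_, ?_, ?_, ?_, ?_, ?_, ?_⟩ <;> nlinarith

theorem sectionGauge_le_iff {ω η : EuclideanSpace ℝ (Fin 2)} (hω : ω ∈ Metric.sphere 0 1)
    (hη : η ∈ Metric.sphere 0 1) (w : EuclideanSpace ℝ (Fin 2)) (t : ℝ) :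
    sectionGauge ω η w ≤ t ↔
      ((w 1 ≤ t * (1 / 4) ∧ -w 1 ≤ t * (3 / 4)) ∧ -16 * w 0 - w 1 ≤ t * (1 / 4) ∧
        -16 * (w 0 * η 0) - w 1 ≤ t * (11 / 4 + 3 / 2 * η 0)) ∧
      ((w 0 * η 0 * ω 0 ≤ t * (1 - (1 / 4 + 3 / 32 * η 0) * ω 0) ∧
        -(w 0 * η 0 * ω 0) ≤ t * (1 + (1 / 4 + 3 / 32 * η 0) * ω 0)) ∧
      w 0 * η 0 * ω 1 ≤ t * (1 / 2 - (1 / 4 + 3 / 32 * η 0) * ω 1) ∧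
        -(w 0 * η 0 * ω 1) ≤ t * (3 / 2 + (1 / 4 + 3 / 32 * η 0) * ω 1)) ∧
      w 0 * η 1 ≤ t * (1 - 3 / 32 * η 1) ∧ -(w 0 * η 1) ≤ t * (1 + 3 / 32 * η 1) := by
  obtain ⟨h1, h2, h3, h4, h5, h6, h7⟩ := sectionGauge_slack_pos hω hη
  simp only [sectionGauge, max_le_iff]
  rw [div_le_iff₀ (by norm_num), div_le_iff₀ (by norm_num), div_le_iff₀ (by norm_num),
    div_le_iff₀ h1, div_le_iff₀ h2, div_le_iff₀ h3, div_le_iff₀ h4, div_le_iff₀ h5,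
    div_le_iff₀ h6, div_le_iff₀ h7]

theorem isStarGauge_sectionGauge {ω η : EuclideanSpace ℝ (Fin 2)} (hω : ω ∈ Metric.sphere 0 1)
    (hη : η ∈ Metric.sphere 0 1) : IsStarGauge (sectionGauge ω η) where
  smul t w ht := by
    simp only [sectionGauge, mul_max_of_nonneg _ _ ht, PiLp.smul_apply, smul_eq_mul]
    congr 1 <;> (try congr 1) <;> congr 1 <;> (try congr 1) <;> ring
  pos w hw := by
    by_contra! h
    obtain ⟨⟨⟨a1, a2⟩, -, -⟩, ⟨⟨a5, a6⟩, a7, a8⟩, a9, a10⟩ := (sectionGauge_le_iff hω hη w 0).1 h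
    have b1 : w 1 = 0 := by linarith
    have b2 : w 0 * η 0 * ω 0 = 0 := by linarith
    have b3 : w 0 * η 0 * ω 1 = 0 := by linarith
    have b4 : w 0 * η 1 = 0 := by linarith
    have b5 : w 0 * η 0 = 0 := by
      have := sphere_two_sq hω
      linear_combination (w 0 * η 0) * (-this) + ω 0 * b2 + ω 1 * b3
    have b6 : w 0 = 0 := by
      have := sphere_two_sq hη
      linear_combination w 0 * (-this) + η 0 * b5 + η 1 * b4
    exact hw (by ext i; fin_cases i <;> simp [b1, b6])

theorem continuous_sectionGauge :
    Continuous fun p : (Metric.sphere (0 : EuclideanSpace ℝ (Fin 2)) 1 ×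
        Metric.sphere (0 : EuclideanSpace ℝ (Fin 2)) 1) × EuclideanSpace ℝ (Fin 2) =>
      sectionGauge p.1.1 p.1.2 p.2 := by
  have h := fun p : (Metric.sphere (0 : EuclideanSpace ℝ (Fin 2)) 1 ×
      Metric.sphere (0 : EuclideanSpace ℝ (Fin 2)) 1) × EuclideanSpace ℝ (Fin 2) =>
    sectionGauge_slack_pos p.1.1.2 p.1.2.2
  unfold sectionGauge
  have d : ∀ {f g : (Metric.sphere (0 : EuclideanSpace ℝ (Fin 2)) 1 ×
      Metric.sphere (0 : EuclideanSpace ℝ (Fin 2)) 1) × EuclideanSpace ℝ (Fin 2) → ℝ},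
      Continuous f → Continuous g → (∀ p, 0 < g p) → Continuous fun p => f p / g p :=
    fun hf hg hp => hf.div hg fun p => (hp p).ne'
  refine ((Continuous.max ?_ ?_).max (Continuous.max ?_ ?_)).max
    (((Continuous.max ?_ ?_).max (Continuous.max ?_ ?_)).max (Continuous.max ?_ ?_))
  · fun_prop
  · fun_prop
  · fun_prop
  · exact d (by fun_prop) (by fun_prop) fun p => (h p).1
  · exact d (by fun_prop) (by fun_prop) fun p => (h p).2.1
  · exact d (by fun_prop) (by fun_prop) fun p => (h p).2.2.1
  · exact d (by fun_prop) (by fun_prop) fun p => (h p).2.2.2.1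
  · exact d (by fun_prop) (by fun_prop) fun p => (h p).2.2.2.2.1
  · exact d (by fun_prop) (by fun_prop) fun p => (h p).2.2.2.2.2.1
  · exact d (by fun_prop) (by fun_prop) fun p => (h p).2.2.2.2.2.2

/-- The distance in the `(a, u)`-plane to the point `(0, 1/2)`. -/
noncomputable def axisDist (a u : ℝ) : ℝ :=
  √(a ^ 2 + (u - 1 / 2) ^ 2)

/-- The distance in `(a, u, v)`-space to the circle of radius `1/4` about `(0, 1/2, 0)` in the
`(a, u)`-plane. -/
noncomputable def circleDist (a u v : ℝ) : ℝ :=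
  √((axisDist a u - 1 / 4) ^ 2 + v ^ 2)

/-- A height function exceeding `1` exactly near the vertical axis and near the circle of
radius `1/4` around it, and supported in `0 < u`. -/
noncomputable def bump (a u v : ℝ) : ℝ :=
  max 0 (max (2 - 16 * axisDist a u) (2 - 16 * circleDist a u v))

theorem continuous_bump : Continuous fun m : ℝ × ℝ × ℝ => bump m.1 m.2.1 m.2.2 := by
  unfold bump circleDist axisDist
  fun_prop

theorem bump_nonneg (a u v : ℝ) : 0 ≤ bump a u v :=
  le_max_left _ _

theorem bump_eq_zero {a u v : ℝ} (hu : u ≤ 0) : bump a u v = 0 := by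
  have h1 : 1 / 2 ≤ axisDist a u := Real.le_sqrt_of_sq_le (by nlinarith)
  have h2 : 1 / 4 ≤ circleDist a u v := Real.le_sqrt_of_sq_le (by nlinarith)
  exact max_eq_left (max_le (by linarith) (by linarith))

/-- The part of the box `[-1, 1]³ × [0, 1]` above the graph of `bump`. -/
def torusSolid : Set (ℝ × ℝ × ℝ × ℝ) :=
  {m | (|m.1| ≤ 1 ∧ |m.2.1| ≤ 1 ∧ |m.2.2.1| ≤ 1) ∧
    bump m.1 m.2.1 m.2.2.1 ≤ m.2.2.2 ∧ m.2.2.2 ≤ 1}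

/-- Toroidal coordinates: `ω` is the angle around the axis, `η` the angle around the circle
of radius `1/4`, and `w` the position in the cross section relative to `(3/32, 3/4)`. -/
noncomputable def toroidal (ω η w : EuclideanSpace ℝ (Fin 2)) : ℝ × ℝ × ℝ × ℝ :=
  ((1 / 4 + (3 / 32 + w 0) * η 0) * ω 0, 1 / 2 + (1 / 4 + (3 / 32 + w 0) * η 0) * ω 1,
    (3 / 32 + w 0) * η 1, 3 / 4 + w 1)

theorem continuous_toroidal {X : Type*} [TopologicalSpace X]
    {f g h : X → EuclideanSpace ℝ (Fin 2)} (hf : Continuous f) (hg : Continuous g)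
    (hh : Continuous h) : Continuous fun x => toroidal (f x) (g x) (h x) := by
  unfold toroidal
  fun_prop

theorem axisDist_toroidal {ω : EuclideanSpace ℝ (Fin 2)} (hω : ω ∈ Metric.sphere 0 1) {k : ℝ}
    (hk : 0 ≤ k) : axisDist (k * ω 0) (1 / 2 + k * ω 1) = k := by
  rw [axisDist, Real.sqrt_eq_iff_mul_self_eq (by positivity) hk]
  linear_combination k ^ 2 * sphere_two_sq hω

theorem circleDist_toroidal {ω η : EuclideanSpace ℝ (Fin 2)} (hω : ω ∈ Metric.sphere 0 1)
    (hη : η ∈ Metric.sphere 0 1) {r : ℝ} (hr : 0 ≤ r) (hk : 0 ≤ 1 / 4 + r * η 0) :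
    circleDist ((1 / 4 + r * η 0) * ω 0) (1 / 2 + (1 / 4 + r * η 0) * ω 1) (r * η 1) = r := by
  rw [circleDist, axisDist_toroidal hω hk, Real.sqrt_eq_iff_mul_self_eq (by positivity) hr]
  linear_combination r ^ 2 * sphere_two_sq hη

theorem toroidal_mem_iff {ω η w : EuclideanSpace ℝ (Fin 2)} (hω : ω ∈ Metric.sphere 0 1)
    (hη : η ∈ Metric.sphere 0 1) (hr : 0 ≤ 3 / 32 + w 0)
    (hk : 0 ≤ 1 / 4 + (3 / 32 + w 0) * η 0) :
    toroidal ω η w ∈ torusSolid ↔ sectionGauge ω η w ≤ 1 := by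
  rw [sectionGauge_le_iff hω hη]
  simp only [torusSolid, toroidal, mem_ofPred_eq, bump, axisDist_toroidal hω hk,
    circleDist_toroidal hω hη hr hk, max_le_iff, abs_le]
  constructor
  · rintro ⟨⟨⟨a1, a2⟩, ⟨a3, a4⟩, a5, a6⟩, ⟨a7, a8, a9⟩, a10⟩
    refine ⟨⟨⟨?_, ?_⟩, ?_, ?_⟩, ⟨⟨?_, ?_⟩, ?_, ?_⟩, ?_, ?_⟩ <;> linarith
  · rintro ⟨⟨⟨a1, a2⟩, a3, a4⟩, ⟨⟨a5, a6⟩, a7, a8⟩, a9, a10⟩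
    refine ⟨⟨⟨?_, ?_⟩, ⟨?_, ?_⟩, ?_, ?_⟩, ⟨?_, ?_, ?_⟩, ?_⟩ <;> linarith

theorem radii_pos_of_sectionGauge_le {ω η w : EuclideanSpace ℝ (Fin 2)}
    (hω : ω ∈ Metric.sphere 0 1) (hη : η ∈ Metric.sphere 0 1) (h : sectionGauge ω η w ≤ 1) :
    0 < 3 / 32 + w 0 ∧ 0 < 1 / 4 + (3 / 32 + w 0) * η 0 := by
  obtain ⟨⟨⟨a1, -⟩, a3, a4⟩, -⟩ := (sectionGauge_le_iff hω hη w 1).1 h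
  constructor <;> linarith

theorem sphere_two_ext {ω ω' : EuclideanSpace ℝ (Fin 2)} {k : ℝ} (hk : 0 < k)
    (h0 : k * ω 0 = k * ω' 0) (h1 : k * ω 1 = k * ω' 1) : ω = ω' := by
  ext i
  fin_cases i
  · exact mul_left_cancel₀ hk.ne' h0
  · exact mul_left_cancel₀ hk.ne' h1

theorem toroidal_injective {ω η w ω' η' w' : EuclideanSpace ℝ (Fin 2)}
    (hω : ω ∈ Metric.sphere 0 1) (hη : η ∈ Metric.sphere 0 1) (hw : sectionGauge ω η w ≤ 1)
    (hω' : ω' ∈ Metric.sphere 0 1) (hη' : η' ∈ Metric.sphere 0 1)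
    (hw' : sectionGauge ω' η' w' ≤ 1) (h : toroidal ω η w = toroidal ω' η' w') :
    ω = ω' ∧ η = η' ∧ w = w' := by
  obtain ⟨hr, hk⟩ := radii_pos_of_sectionGauge_le hω hη hw
  obtain ⟨hr', hk'⟩ := radii_pos_of_sectionGauge_le hω' hη' hw'
  simp only [toroidal, Prod.mk.injEq] at h
  obtain ⟨h1, h2, h3, h4⟩ := h
  have e1 := axisDist_toroidal hω hk.le
  rw [h1, h2, axisDist_toroidal hω' hk'.le] at e1
  have e2 := circleDist_toroidal hω hη hr.le hk.le
  rw [h1, h2, h3, circleDist_toroidal hω' hη' hr'.le hk'.le] at e2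
  rw [e1] at h1 h2
  rw [e2] at h3
  rw [e2] at e1
  refine ⟨sphere_two_ext hk h1 (by linarith), sphere_two_ext hr (by linarith) h3, ?_⟩
  · ext i
    fin_cases i
    · simp only [Fin.zero_eta]; linarith
    · simp only [Fin.mk_one]; linarith

theorem exists_sphere_two {x y r : ℝ} (hr : 0 < r) (h : √(x ^ 2 + y ^ 2) = r) :
    ∃ ω ∈ Metric.sphere (0 : EuclideanSpace ℝ (Fin 2)) 1, x = r * ω 0 ∧ y = r * ω 1 := by
  have h1 : x ^ 2 + y ^ 2 = r ^ 2 := by rw [← h, Real.sq_sqrt (by positivity)]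
  refine ⟨!₂[x / r, y / r], ?_, ?_, ?_⟩
  · rw [mem_sphere_zero_iff_norm, EuclideanSpace.norm_eq, Real.sqrt_eq_one]
    simp only [Fin.sum_univ_two, Real.norm_eq_abs, sq_abs, Matrix.cons_val_zero, Matrix.cons_val_one]
    field_simp
    exact h1
  · simp; field_simp
  · simp; field_simp

theorem exists_toroidal {m : ℝ × ℝ × ℝ × ℝ} (hm : m ∈ torusSolid) :
    ∃ ω ∈ Metric.sphere (0 : EuclideanSpace ℝ (Fin 2)) 1,
    ∃ η ∈ Metric.sphere (0 : EuclideanSpace ℝ (Fin 2)) 1, ∃ w : EuclideanSpace ℝ (Fin 2),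
      sectionGauge ω η w ≤ 1 ∧ toroidal ω η w = m := by
  obtain ⟨a, u, v, b⟩ := m
  have hm' := hm
  simp only [torusSolid, mem_ofPred_eq, bump, max_le_iff] at hm'
  obtain ⟨-, ⟨-, h1, h2⟩, h3⟩ := hm'
  have hk : 0 < axisDist a u := by linarith
  have hr : 0 < circleDist a u v := by linarith
  obtain ⟨ω, hω, e1, e2⟩ := exists_sphere_two hk rfl
  obtain ⟨η, hη, e3, e4⟩ := exists_sphere_two hr rfl
  have e5 : toroidal ω η !₂[circleDist a u v - 3 / 32, b - 3 / 4] = (a, u, v, b) := by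
    have e6 : 1 / 4 + circleDist a u v * η 0 = axisDist a u := by linarith
    simp only [toroidal, Matrix.cons_val_zero, Matrix.cons_val_one,
      add_sub_cancel, e6, ← e1, ← e2, ← e4]
  refine ⟨ω, hω, η, hη, _, ?_, e5⟩
  rw [← toroidal_mem_iff hω hη, e5]
  · exact hm
  · simpa using hr.le
  · simp only [Matrix.cons_val_zero, add_sub_cancel]
    linarith

/-- The solid `T² × D²`. -/
abbrev TorusTimesDisk : Type :=
  (Metric.sphere (0 : EuclideanSpace ℝ (Fin 2)) 1 ×
    Metric.sphere (0 : EuclideanSpace ℝ (Fin 2)) 1) ×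
    Metric.closedBall (0 : EuclideanSpace ℝ (Fin 2)) 1

/-- A parametrization of `torusSolid` by `T² × D²`. -/
noncomputable def solidParam (p : TorusTimesDisk) : ℝ × ℝ × ℝ × ℝ :=
  toroidal p.1.1 p.1.2 (radialRescale (fun w => ‖w‖) (sectionGauge p.1.1 p.1.2) p.2)

theorem sectionGauge_radialRescale (p : TorusTimesDisk) :
    sectionGauge p.1.1 p.1.2 (radialRescale (fun w => ‖w‖) (sectionGauge p.1.1 p.1.2) p.2) ≤ 1 := by
  rw [IsStarGauge.norm.gauge_radialRescale (isStarGauge_sectionGauge p.1.1.2 p.1.2.2)]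
  exact mem_closedBall_zero_iff.1 p.2.2

theorem continuous_solidParam : Continuous solidParam := by
  have h0 := continuous_radialRescale (N := fun _ w => ‖w‖)
    (γ := fun x : Metric.sphere (0 : EuclideanSpace ℝ (Fin 2)) 1 ×
      Metric.sphere (0 : EuclideanSpace ℝ (Fin 2)) 1 => sectionGauge x.1 x.2)
    (fun _ => IsStarGauge.norm) (fun x => isStarGauge_sectionGauge x.1.2 x.2.2)
    (by fun_prop) continuous_sectionGauge
  have h1 : Continuous fun p : TorusTimesDisk =>
      radialRescale (fun w => ‖w‖) (sectionGauge p.1.1 p.1.2) (p.2 : EuclideanSpace ℝ (Fin 2)) :=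
    h0.comp (f := fun p : TorusTimesDisk => (p.1, (p.2 : EuclideanSpace ℝ (Fin 2))))
      (by fun_prop)
  exact continuous_toroidal (by fun_prop) (by fun_prop) h1

theorem solidParam_injective : Function.Injective solidParam := by
  rintro ⟨⟨⟨ω, hω⟩, ⟨η, hη⟩⟩, ⟨w, hw⟩⟩ ⟨⟨⟨ω', hω'⟩, ⟨η', hη'⟩⟩, ⟨w', hw'⟩⟩ h
  obtain ⟨rfl, rfl, e⟩ := toroidal_injective hω hη
    (sectionGauge_radialRescale ⟨⟨⟨ω, hω⟩, ⟨η, hη⟩⟩, ⟨w, hw⟩⟩) hω' hη'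
    (sectionGauge_radialRescale ⟨⟨⟨ω', hω'⟩, ⟨η', hη'⟩⟩, ⟨w', hw'⟩⟩) h
  obtain rfl := IsStarGauge.norm.radialRescale_injective (isStarGauge_sectionGauge hω hη) e
  rfl

theorem range_solidParam : range solidParam = torusSolid := by
  ext m
  constructor
  · rintro ⟨p, rfl⟩
    have h := sectionGauge_radialRescale p
    obtain ⟨hr, hk⟩ := radii_pos_of_sectionGauge_le p.1.1.2 p.1.2.2 h
    exact (toroidal_mem_iff p.1.1.2 p.1.2.2 hr.le hk.le).2 h
  · intro hm
    obtain ⟨ω, hω, η, hη, w, hw, rfl⟩ := exists_toroidal hm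
    have hg := isStarGauge_sectionGauge hω hη
    refine ⟨⟨⟨⟨ω, hω⟩, ⟨η, hη⟩⟩, ⟨radialRescale (sectionGauge ω η) (fun w => ‖w‖) w, ?_⟩⟩, ?_⟩
    · rw [mem_closedBall_zero_iff]
      exact (hg.gauge_radialRescale IsStarGauge.norm w).trans_le hw
    · simp only [solidParam, hg.radialRescale_radialRescale IsStarGauge.norm]

/-- The depth of the dent mirroring `bump`. -/
noncomputable def dent (a u v : ℝ) : ℝ :=
  min 1 (bump a (-u) v)

theorem continuous_dent : Continuous fun m : ℝ × ℝ × ℝ => dent m.1 m.2.1 m.2.2 :=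
  continuous_const.min (continuous_bump.comp
    (f := fun m : ℝ × ℝ × ℝ => ((m.1, -m.2.1, m.2.2) : ℝ × ℝ × ℝ)) (by fun_prop))

theorem dent_nonneg (a u v : ℝ) : 0 ≤ dent a u v :=
  le_min zero_le_one (bump_nonneg _ _ _)

theorem dent_eq_zero {a u v : ℝ} (hu : 0 ≤ u) : dent a u v = 0 := by
  rw [dent, bump_eq_zero (by linarith)]
  norm_num

/-- The tile in the model coordinates: the half box above the graph of `bump`, together with
its mirror image below the dent. -/
def modelTile : Set (ℝ × ℝ × ℝ × ℝ) :=
  {m | (|m.1| ≤ 1 ∧ |m.2.1| ≤ 1 ∧ |m.2.2.1| ≤ 1) ∧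
    bump m.1 m.2.1 m.2.2.1 - dent m.1 m.2.1 m.2.2.1 ≤ m.2.2.2 ∧ m.2.2.2 ≤ 1}

/-- Stretches the vertical segments of the half box down into the dent. -/
noncomputable def pushDown (m : ℝ × ℝ × ℝ × ℝ) : ℝ × ℝ × ℝ × ℝ :=
  (m.1, m.2.1, m.2.2.1, (1 + dent m.1 m.2.1 m.2.2.1) * m.2.2.2 - dent m.1 m.2.1 m.2.2.1)

theorem continuous_pushDown : Continuous pushDown := by
  have h : Continuous fun m : ℝ × ℝ × ℝ × ℝ => dent m.1 m.2.1 m.2.2.1 :=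
    continuous_dent.comp (f := fun m : ℝ × ℝ × ℝ × ℝ => ((m.1, m.2.1, m.2.2.1) : ℝ × ℝ × ℝ))
      (by fun_prop)
  unfold pushDown
  fun_prop

theorem pushDown_injective : Function.Injective pushDown := by
  rintro ⟨a, u, v, b⟩ ⟨a', u', v', b'⟩ h
  simp only [pushDown, Prod.mk.injEq] at h
  obtain ⟨rfl, rfl, rfl, h⟩ := h
  have := dent_nonneg a u v
  rw [sub_left_inj, mul_right_inj' (by linarith)] at h
  rw [h]

theorem pushDown_image : pushDown '' torusSolid = modelTile := by
  ext ⟨a, u, v, b⟩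
  have hd := dent_nonneg a u v
  have hz : bump a u v * dent a u v = 0 := by
    rcases le_total u 0 with h | h
    · rw [bump_eq_zero h, zero_mul]
    · rw [dent_eq_zero h, mul_zero]
  constructor
  · rintro ⟨⟨a', u', v', b'⟩, ⟨h1, h2, h3⟩, h⟩
    simp only [pushDown, Prod.mk.injEq] at h
    obtain ⟨rfl, rfl, rfl, rfl⟩ := h
    refine ⟨h1, ?_, ?_⟩
    · dsimp only at h2 ⊢
      nlinarith
    · dsimp only at h3 ⊢
      nlinarith
  · rintro ⟨h1, h2, h3⟩
    dsimp only at h1 h2 h3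
    refine ⟨(a, u, v, (b + dent a u v) / (1 + dent a u v)), ⟨h1, ?_, ?_⟩, ?_⟩
    · dsimp only
      rw [le_div_iff₀ (by linarith)]
      linarith
    · dsimp only
      rw [div_le_one (by linarith)]
      linarith
    · simp only [pushDown, Prod.mk.injEq, true_and]
      rw [mul_div_cancel₀ _ (by linarith)]
      ring

theorem modelTile_norm_le {m : ℝ × ℝ × ℝ × ℝ} (hm : m ∈ modelTile) : ‖m‖ ≤ 1 := by
  obtain ⟨a, u, v, b⟩ := m
  obtain ⟨⟨h1, h2, h3⟩, h4, h5⟩ := hm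
  dsimp only at h1 h2 h3 h4 h5
  have h6 := bump_nonneg a u v
  have h7 : dent a u v ≤ 1 := min_le_left _ _
  simp only [Prod.norm_def, Real.norm_eq_abs, max_le_iff]
  exact ⟨h1, h2, h3, abs_le.2 ⟨by linarith, h5⟩⟩

theorem modelTile_nonneg_or {m : ℝ × ℝ × ℝ × ℝ} (hm : m ∈ modelTile) :
    0 ≤ m.2.2.2 ∨ m.2.1 ≤ 0 := by
  rw [or_iff_not_imp_right, not_le]
  intro h
  have h1 := hm.2.1
  rw [dent_eq_zero h.le] at h1
  linarith [bump_nonneg m.1 m.2.1 m.2.2.1]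

section Sectors

open Complex

theorem sector_eq_of_eq {ζ : ℂ} (hs : 0 < ζ.im) {x y x' y' : ℝ}
    (h : (x + y * ζ : ℂ) = x' + y' * ζ) : x = x' ∧ y = y' := by
  have h1 := congrArg Complex.im h
  have h2 := congrArg Complex.re h
  simp at h1 h2
  have h3 : y = y' := by
    rcases h1 with h1 | h1
    · exact h1
    · exact absurd h1 hs.ne'
  subst h3
  exact ⟨by linarith, rfl⟩

theorem exp_ofReal_mul_I_eq (θ : ℝ) : exp (θ * I) = Real.cos θ + Real.sin θ * I := by
  rw [exp_mul_I, ofReal_cos, ofReal_sin]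

theorem exists_sector {n : ℕ} (hn : 3 ≤ n) (z : ℂ) :
    ∃ (k : ℕ) (x y : ℝ), 0 ≤ x ∧ 0 ≤ y ∧
      z = exp ((2 * Real.pi / n : ℝ) * I) ^ k * (x + y * exp ((2 * Real.pi / n : ℝ) * I)) := by
  have hn' : (3 : ℝ) ≤ n := by exact_mod_cast hn
  set α : ℝ := 2 * Real.pi / n with hα
  have hα0 : 0 < α := by positivity
  have hαπ : α < Real.pi := by
    rw [hα, div_lt_iff₀ (by linarith)]
    nlinarith [Real.pi_pos]
  have hsin : 0 < Real.sin α := Real.sin_pos_of_pos_of_lt_pi hα0 hαπ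
  obtain ⟨θ, hθ0, hθ⟩ : ∃ θ : ℝ, 0 ≤ θ ∧ z = ‖z‖ * exp (θ * I) := by
    rcases le_or_gt 0 z.arg with h | h
    · exact ⟨z.arg, h, (norm_mul_exp_arg_mul_I z).symm⟩
    · refine ⟨z.arg + 2 * Real.pi, by linarith [neg_pi_lt_arg z, Real.pi_pos], ?_⟩
      push_cast
      rw [add_mul, exp_periodic, norm_mul_exp_arg_mul_I]
  have hk := Nat.floor_le (div_nonneg hθ0 hα0.le)
  have hk' := (Nat.lt_floor_add_one (θ / α)).le
  set k := ⌊θ / α⌋₊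
  rw [le_div_iff₀ hα0] at hk
  rw [div_le_iff₀ hα0] at hk'
  refine ⟨k, ‖z‖ * Real.sin (α - (θ - k * α)) / Real.sin α,
    ‖z‖ * Real.sin (θ - k * α) / Real.sin α, ?_, ?_, ?_⟩
  · refine div_nonneg (mul_nonneg (norm_nonneg _) ?_) hsin.le
    exact Real.sin_nonneg_of_nonneg_of_le_pi (by linarith) (by linarith)
  · refine div_nonneg (mul_nonneg (norm_nonneg _) ?_) hsin.le
    exact Real.sin_nonneg_of_nonneg_of_le_pi (by linarith) (by linarith)
  · conv_lhs => rw [hθ, show (θ : ℝ) = k * α + (θ - k * α) by ring]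
    generalize θ - k * α = φ
    have hsin' : (Real.sin α : ℂ) ≠ 0 := by exact_mod_cast hsin.ne'
    rw [← exp_nat_mul, show (((k * α + φ : ℝ) : ℂ) * I) = k * (α * I) + φ * I by
      push_cast; ring, exp_add, exp_ofReal_mul_I_eq α, exp_ofReal_mul_I_eq φ, Real.sin_sub]
    push_cast at hsin' ⊢
    field_simp
    ring

theorem sector_unique {n : ℕ} (hn : 3 ≤ n) {ζ : ℂ} (hζ : ζ = exp ((2 * Real.pi / n : ℝ) * I))
    {k i : ℕ} {x y x' y' : ℝ} (hx : 0 < x) (hy : 0 < y) (hx' : 0 ≤ x') (hy' : 0 ≤ y')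
    (h : ζ ^ k * (x + y * ζ) = ζ ^ i * (x' + y' * ζ)) : ζ ^ k = ζ ^ i := by
  have hn' : (3 : ℝ) ≤ n := by exact_mod_cast hn
  have hζ0 : ζ ≠ 0 := hζ ▸ exp_ne_zero _
  have hprim : IsPrimitiveRoot ζ n := by
    rw [hζ]
    convert isPrimitiveRoot_exp n (by omega) using 2
    push_cast
    ring
  have := NeZero.of_gt (show 2 < n from hn)
  obtain ⟨j, hj, hj'⟩ := hprim.eq_pow_of_pow_eq_one (ξ := ζ ^ k / ζ ^ i) (by
    rw [div_pow, ← pow_mul, ← pow_mul, mul_comm k, mul_comm i, pow_mul, pow_mul, hprim.pow_eq_one,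
      one_pow, one_pow, div_one])
  have h0 : ζ ^ j * (x + y * ζ) = x' + y' * ζ := by
    rw [hj', div_mul_eq_mul_div, h, mul_div_cancel_left₀ _ (pow_ne_zero _ hζ0)]
  rcases Nat.eq_zero_or_pos j with rfl | hjpos
  · rw [pow_zero, eq_div_iff (pow_ne_zero _ hζ0), one_mul] at hj'
    exact hj'.symm
  exfalso
  set α : ℝ := 2 * Real.pi / n with hα
  have hα0 : 0 < α := by positivity
  have hnα : n * α = 2 * Real.pi := by rw [hα]; field_simp
  have hαπ : α < Real.pi := by nlinarith [Real.pi_pos]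
  have hsin : 0 < Real.sin α := Real.sin_pos_of_pos_of_lt_pi hα0 hαπ
  have hexp : ζ ^ j = exp ((j * α : ℝ) * I) := by
    rw [hζ, ← exp_nat_mul]; push_cast; ring_nf
  have hj1 : (1 : ℝ) ≤ j := by exact_mod_cast hjpos
  have hj2 : (j : ℝ) + 1 ≤ n := by exact_mod_cast hj
  rw [hexp, hζ, exp_ofReal_mul_I_eq, exp_ofReal_mul_I_eq] at h0
  have hre := congrArg Complex.re h0
  have him := congrArg Complex.im h0
  simp [-ofReal_cos, -ofReal_sin] at hre him
  have hsum : Real.sin (j * α + α) = Real.sin (j * α) * Real.cos α +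
    Real.cos (j * α) * Real.sin α := Real.sin_add _ _
  have hdiff : Real.sin (j * α - α) = Real.sin (j * α) * Real.cos α -
    Real.cos (j * α) * Real.sin α := Real.sin_sub _ _
  have hsq := Real.sin_sq_add_cos_sq α
  have e1 : x * Real.sin (j * α) + y * Real.sin (j * α + α) = y' * Real.sin α := by
    rw [hsum]; linarith
  have e2 : x * Real.sin (j * α - α) + y * Real.sin (j * α) = -(x' * Real.sin α) := by
    rw [hdiff]
    linear_combination Real.cos α * him - Real.sin α * hre - y * Real.sin (j * α) * hsq
  rcases le_or_gt (j * α) Real.pi with hle | hlt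
  · have h1 : 0 ≤ Real.sin (j * α - α) :=
      Real.sin_nonneg_of_nonneg_of_le_pi (by nlinarith) (by linarith)
    have h2 : 0 ≤ Real.sin (j * α) :=
      Real.sin_nonneg_of_nonneg_of_le_pi (by positivity) hle
    have h3 : 0 ≤ x' * Real.sin α := by positivity
    have h4 : 0 ≤ x * Real.sin (j * α - α) := by positivity
    have h5 : 0 ≤ y * Real.sin (j * α) := by positivity
    have h6 : Real.sin (j * α) = 0 :=
      (mul_eq_zero.1 (show y * Real.sin (j * α) = 0 by linarith)).resolve_left hy.ne'
    have h7 : Real.sin (j * α - α) = 0 :=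
      (mul_eq_zero.1 (show x * Real.sin (j * α - α) = 0 by linarith)).resolve_left hx.ne'
    have h8 : Real.cos (j * α) = 0 := by
      rw [h7, h6] at hdiff
      exact (mul_eq_zero.1 (show Real.cos (j * α) * Real.sin α = 0 by linarith)).resolve_right
        hsin.ne'
    have := Real.sin_sq_add_cos_sq (j * α)
    rw [h6, h8] at this
    norm_num at this
  · have h1 : Real.sin (j * α) < 0 := by
      rw [← Real.sin_sub_two_pi]
      exact Real.sin_neg_of_neg_of_neg_pi_lt (by nlinarith) (by linarith)
    have h2 : Real.sin (j * α + α) ≤ 0 := by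
      rw [← Real.sin_sub_two_pi]
      exact Real.sin_nonpos_of_nonpos_of_neg_pi_le (by nlinarith) (by linarith)
    have h3 : 0 ≤ y' * Real.sin α := by positivity
    nlinarith

end Sectors

/-- Rotation of the first factor of `ℂ × ℂ`. -/
noncomputable def rotateFst (c : Circle) : WithLp 2 (ℂ × ℂ) ≃ₗᵢ[ℝ] WithLp 2 (ℂ × ℂ) :=
  LinearIsometryEquiv.withLpProdCongr 2 (rotation c) (LinearIsometryEquiv.refl ℝ ℂ)

theorem rotateFst_apply (c : Circle) (z w : ℂ) :
    rotateFst c (WithLp.toLp 2 (z, w)) = WithLp.toLp 2 (c * z, w) := by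
  simp [rotateFst, rotation_apply]

theorem rotateFst_mul (c d : Circle) (y : WithLp 2 (ℂ × ℂ)) :
    rotateFst (c * d) y = rotateFst c (rotateFst d y) := by
  obtain ⟨z, w⟩ := y
  simp [rotateFst_apply, mul_assoc]

theorem rotateFst_one (y : WithLp 2 (ℂ × ℂ)) : rotateFst 1 y = y := by
  obtain ⟨z, w⟩ := y
  simp [rotateFst_apply]

/-- The piecewise linear map sending the half space `0 ≤ b` to the sector spanned by `1` and `ζ`
(times `ℂ`), and the quadrant `b ≤ 0`, `u ≤ 0` to a part of the sector spanned by `ζ`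
and `ζ ^ 2`. -/
noncomputable def wedgeMap (ζ : ℂ) (m : ℝ × ℝ × ℝ × ℝ) : WithLp 2 (ℂ × ℂ) :=
  WithLp.toLp 2 (((max m.2.2.2 0 + max m.2.1 0 : ℝ) : ℂ) +
    ((|m.2.2.2| + max (-m.2.1) 0 : ℝ) : ℂ) * ζ + ((max (-m.2.2.2) 0 : ℝ) : ℂ) * ζ ^ 2,
    (m.1 : ℂ) + (m.2.2.1 : ℂ) * Complex.I)

theorem continuous_wedgeMap (ζ : ℂ) : Continuous (wedgeMap ζ) := by
  unfold wedgeMap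
  fun_prop

theorem wedgeMap_smul (ζ : ℂ) {t : ℝ} (ht : 0 ≤ t) (m : ℝ × ℝ × ℝ × ℝ) :
    wedgeMap ζ (t • m) = t • wedgeMap ζ m := by
  obtain ⟨a, u, v, b⟩ := m
  have h : ∀ r : ℝ, max (t * r) 0 = t * max r 0 := fun r => by
    rw [mul_max_of_nonneg _ _ ht, mul_zero]
  have h' : ∀ r : ℝ, max (-(t * r)) 0 = t * max (-r) 0 := fun r => by
    rw [← h, mul_neg]
  rw [wedgeMap, wedgeMap, ← WithLp.toLp_smul]
  simp only [Prod.smul_mk, smul_eq_mul, h, h', abs_mul, abs_of_nonneg ht, Complex.real_smul]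
  congr 2
  · push_cast; ring
  · push_cast; ring

theorem wedgeMap_of_nonneg (ζ : ℂ) {a u v b : ℝ} (hb : 0 ≤ b) :
    wedgeMap ζ (a, u, v, b) = WithLp.toLp 2 (((b + max u 0 : ℝ) : ℂ) +
      ((b + max (-u) 0 : ℝ) : ℂ) * ζ, (a : ℂ) + (v : ℂ) * Complex.I) := by
  simp [wedgeMap, abs_of_nonneg hb, hb]

/-- The symmetry of the model coordinates corresponding to the rotation by `ζ`. -/
def mirror (m : ℝ × ℝ × ℝ × ℝ) : ℝ × ℝ × ℝ × ℝ :=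
  (m.1, -m.2.1, m.2.2.1, -m.2.2.2)

theorem mirror_mirror (m : ℝ × ℝ × ℝ × ℝ) : mirror (mirror m) = m := by
  simp [mirror]

theorem mirror_smul (t : ℝ) (m : ℝ × ℝ × ℝ × ℝ) : mirror (t • m) = t • mirror m := by
  simp [mirror]

theorem norm_mirror (m : ℝ × ℝ × ℝ × ℝ) : ‖mirror m‖ = ‖m‖ := by
  simp [mirror, Prod.norm_def]

theorem wedgeMap_mirror (ζ : Circle) {m : ℝ × ℝ × ℝ × ℝ} (hb : 0 ≤ m.2.2.2) (hu : 0 ≤ m.2.1) :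
    wedgeMap ζ (mirror m) = rotateFst ζ (wedgeMap ζ m) := by
  obtain ⟨a, u, v, b⟩ := m
  dsimp only at hb hu
  rw [wedgeMap_of_nonneg _ hb, rotateFst_apply, wedgeMap, mirror]
  simp only [abs_neg, abs_of_nonneg hb, neg_neg, max_eq_left hb, max_eq_left hu,
    max_eq_right (neg_nonpos.2 hb), max_eq_right (neg_nonpos.2 hu)]
  congr 2
  push_cast
  ring

theorem max_sub_max_neg (u : ℝ) : max u 0 - max (-u) 0 = u := by
  rcases le_total u 0 with h | h
  · rw [max_eq_right h, max_eq_left (by linarith)]; ring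
  · rw [max_eq_left h, max_eq_right (by linarith)]; ring

theorem wedgeMap_injOn_nonneg {ζ : ℂ} (hζ : 0 < ζ.im) {m m' : ℝ × ℝ × ℝ × ℝ}
    (hb : 0 ≤ m.2.2.2) (hb' : 0 ≤ m'.2.2.2) (h : wedgeMap ζ m = wedgeMap ζ m') : m = m' := by
  obtain ⟨a, u, v, b⟩ := m
  obtain ⟨a', u', v', b'⟩ := m'
  rw [wedgeMap_of_nonneg _ hb, wedgeMap_of_nonneg _ hb'] at h
  obtain ⟨h1, h2⟩ := Prod.mk.inj (WithLp.toLp_injective 2 h)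
  obtain ⟨h3, h4⟩ := sector_eq_of_eq hζ h1
  obtain ⟨h5, h6⟩ := sector_eq_of_eq (ζ := Complex.I) (by simp) h2
  have e1 := max_sub_max_neg u
  have e2 := max_sub_max_neg u'
  obtain rfl : u = u' := by linarith
  obtain rfl : b = b' := by linarith
  rw [h5, h6]

theorem wedgeMap_unique {n : ℕ} (hn : 3 ≤ n) {ζ : Circle} (hζ : 0 < (ζ : ℂ).im)
    (hζn : (ζ : ℂ) = Complex.exp ((2 * Real.pi / n : ℝ) * Complex.I)) {m m' : ℝ × ℝ × ℝ × ℝ}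
    {k i : ℕ} (hb : 0 < m.2.2.2) (hb' : 0 ≤ m'.2.2.2)
    (h : rotateFst (ζ ^ k) (wedgeMap ζ m) = rotateFst (ζ ^ i) (wedgeMap ζ m')) :
    ζ ^ k = ζ ^ i ∧ m = m' := by
  have hki : ζ ^ k = ζ ^ i := by
    obtain ⟨a, u, v, b⟩ := m
    obtain ⟨a', u', v', b'⟩ := m'
    dsimp only at hb hb'
    rw [wedgeMap_of_nonneg _ hb.le, wedgeMap_of_nonneg _ hb', rotateFst_apply,
      rotateFst_apply] at h
    have h1 := (Prod.mk.inj (WithLp.toLp_injective 2 h)).1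
    rw [Circle.coe_pow, Circle.coe_pow] at h1
    have p : ∀ r : ℝ, 0 ≤ max r 0 := fun r => le_max_right _ _
    have := sector_unique hn hζn (add_pos_of_pos_of_nonneg hb (p _))
      (add_pos_of_pos_of_nonneg hb (p _)) (add_nonneg hb' (p _)) (add_nonneg hb' (p _)) h1
    exact Circle.ext (by rw [Circle.coe_pow, Circle.coe_pow, this])
  rw [hki] at h
  exact ⟨hki, wedgeMap_injOn_nonneg hζ hb.le hb' ((rotateFst _).injective h)⟩

/-- The gauge on the model coordinates corresponding to the Euclidean norm. -/
noncomputable def wedgeGauge (ζ : ℂ) (m : ℝ × ℝ × ℝ × ℝ) : ℝ :=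
  ‖wedgeMap ζ (m.1, m.2.1, m.2.2.1, |m.2.2.2|)‖

theorem continuous_wedgeGauge (ζ : ℂ) : Continuous (wedgeGauge ζ) := by
  have := continuous_wedgeMap ζ
  unfold wedgeGauge
  fun_prop

theorem isStarGauge_wedgeGauge {ζ : ℂ} (hζ : 0 < ζ.im) : IsStarGauge (wedgeGauge ζ) where
  smul t m ht := by
    have := wedgeMap_smul ζ ht (m.1, m.2.1, m.2.2.1, |m.2.2.2|)
    simp only [Prod.smul_mk, smul_eq_mul] at this
    simp only [wedgeGauge, Prod.smul_fst, Prod.smul_snd, smul_eq_mul, abs_mul, abs_of_nonneg ht,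
      this, norm_smul, Real.norm_eq_abs]
  pos m hm := by
    refine norm_pos_iff.2 fun h => hm ?_
    have h0 : wedgeMap ζ 0 = 0 := by simpa using wedgeMap_smul ζ le_rfl 0
    have h1 := wedgeMap_injOn_nonneg hζ (abs_nonneg _) le_rfl (h.trans h0.symm)
    simp only [Prod.ext_iff, Prod.fst_zero, Prod.snd_zero, abs_eq_zero] at h1 ⊢
    exact h1

theorem wedgeGauge_of_nonneg (ζ : ℂ) {m : ℝ × ℝ × ℝ × ℝ} (hb : 0 ≤ m.2.2.2) :
    wedgeGauge ζ m = ‖wedgeMap ζ m‖ := by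
  rw [wedgeGauge, abs_of_nonneg hb]

theorem norm_add_mul_circle_comm (ζ : Circle) (x y : ℝ) :
    ‖(y + x * ζ : ℂ)‖ = ‖(x + y * ζ : ℂ)‖ := by
  have h : (y + x * ζ : ℂ) = ζ * starRingEnd ℂ (x + y * ζ) := by
    have h1 : (ζ : ℂ) * starRingEnd ℂ ζ = 1 := by
      rw [Complex.mul_conj, Circle.normSq_coe, Complex.ofReal_one]
    simp only [map_add, map_mul, Complex.conj_ofReal]
    linear_combination (-(y : ℂ)) * h1
  rw [h, norm_mul, Circle.norm_coe, one_mul, Complex.norm_conj]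

theorem wedgeGauge_mirror (ζ : Circle) (m : ℝ × ℝ × ℝ × ℝ) :
    wedgeGauge ζ (mirror m) = wedgeGauge ζ m := by
  obtain ⟨a, u, v, b⟩ := m
  simp only [wedgeGauge, mirror, abs_neg, wedgeMap_of_nonneg _ (abs_nonneg b), neg_neg,
    WithLp.prod_norm_eq_of_L2]
  exact congrArg (fun r => √(r ^ 2 + ‖(a + v * Complex.I : ℂ)‖ ^ 2))
    (norm_add_mul_circle_comm ζ (|b| + max u 0) (|b| + max (-u) 0))

theorem norm_wedgeMap (ζ : Circle) {m : ℝ × ℝ × ℝ × ℝ} (hm : 0 ≤ m.2.2.2 ∨ m.2.1 ≤ 0) :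
    ‖wedgeMap ζ m‖ = wedgeGauge ζ m := by
  rcases le_or_gt 0 m.2.2.2 with hb | hb
  · exact (wedgeGauge_of_nonneg _ hb).symm
  · have hb' : 0 ≤ (mirror m).2.2.2 := neg_nonneg.2 hb.le
    rw [← mirror_mirror m, wedgeMap_mirror ζ hb' (neg_nonneg.2 (hm.resolve_left hb.not_ge)),
      LinearIsometryEquiv.norm_map, wedgeGauge_mirror, wedgeGauge_of_nonneg _ hb']

/-- The primitive rotation by `2π / n`. -/
noncomputable def stepAngle (n : ℕ) : Circle :=
  Circle.exp (2 * Real.pi / n)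

theorem coe_stepAngle (n : ℕ) :
    (stepAngle n : ℂ) = Complex.exp ((2 * Real.pi / n : ℝ) * Complex.I) :=
  Circle.coe_exp _

theorem stepAngle_im_pos {n : ℕ} (hn : 3 ≤ n) : 0 < (stepAngle n : ℂ).im := by
  have hn' : (3 : ℝ) ≤ n := by exact_mod_cast hn
  rw [coe_stepAngle, Complex.exp_ofReal_mul_I_im]
  refine Real.sin_pos_of_pos_of_lt_pi (by positivity) ?_
  rw [div_lt_iff₀ (by positivity)]
  nlinarith [Real.pi_pos]

theorem isPrimitiveRoot_stepAngle {n : ℕ} (hn : n ≠ 0) : IsPrimitiveRoot (stepAngle n) n := by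
  have h : IsPrimitiveRoot (stepAngle n : ℂ) n := by
    convert Complex.isPrimitiveRoot_exp n hn using 1
    rw [coe_stepAngle]
    push_cast
    ring_nf
  exact IsPrimitiveRoot.of_map_of_injective (f := Circle.coeHom) h Circle.coe_injective

theorem wedgeMap_stepAngle_unique {n : ℕ} (hn : 3 ≤ n) {m m' : ℝ × ℝ × ℝ × ℝ} {k i : ℕ}
    (hb : 0 < m.2.2.2) (hb' : 0 ≤ m'.2.2.2)
    (h : rotateFst (stepAngle n ^ k) (wedgeMap (stepAngle n) m) =
      rotateFst (stepAngle n ^ i) (wedgeMap (stepAngle n) m')) :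
    stepAngle n ^ k = stepAngle n ^ i ∧ m = m' :=
  wedgeMap_unique hn (stepAngle_im_pos hn) (coe_stepAngle n) hb hb' h

/-- The map from the model coordinates to `ℂ × ℂ` that carries the sup norm to the
Euclidean norm. -/
noncomputable def tileMap (ζ : ℂ) (m : ℝ × ℝ × ℝ × ℝ) : WithLp 2 (ℂ × ℂ) :=
  wedgeMap ζ (radialRescale (fun w => ‖w‖) (wedgeGauge ζ) m)

theorem continuous_tileMap {ζ : ℂ} (hζ : 0 < ζ.im) : Continuous (tileMap ζ) := by
  have h := continuous_radialRescale (B := Unit) (N := fun _ w => ‖w‖)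
    (γ := fun _ => wedgeGauge ζ) (fun _ => IsStarGauge.norm)
    (fun _ => isStarGauge_wedgeGauge hζ) (by fun_prop)
    ((continuous_wedgeGauge ζ).comp continuous_snd)
  exact (continuous_wedgeMap ζ).comp (h.comp (Continuous.prodMk_right ()))

theorem nonneg_or_radialRescale {ζ : ℂ} (hζ : 0 < ζ.im) {m : ℝ × ℝ × ℝ × ℝ}
    (hm : 0 ≤ m.2.2.2 ∨ m.2.1 ≤ 0) :
    0 ≤ (radialRescale (fun w => ‖w‖) (wedgeGauge ζ) m).2.2.2 ∨
      (radialRescale (fun w => ‖w‖) (wedgeGauge ζ) m).2.1 ≤ 0 :=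
  have ht := IsStarGauge.norm.div_nonneg (isStarGauge_wedgeGauge hζ) m
  hm.imp (mul_nonneg ht) (mul_nonpos_of_nonneg_of_nonpos ht)

theorem norm_tileMap {ζ : Circle} (hζ : 0 < (ζ : ℂ).im) {m : ℝ × ℝ × ℝ × ℝ}
    (hm : 0 ≤ m.2.2.2 ∨ m.2.1 ≤ 0) : ‖tileMap ζ m‖ = ‖m‖ := by
  rw [tileMap, norm_wedgeMap ζ (nonneg_or_radialRescale hζ hm),
    IsStarGauge.norm.gauge_radialRescale (isStarGauge_wedgeGauge hζ)]

theorem tileMap_mirror {ζ : Circle} (hζ : 0 < (ζ : ℂ).im) {m : ℝ × ℝ × ℝ × ℝ}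
    (hb : 0 ≤ m.2.2.2) (hu : 0 ≤ m.2.1) :
    tileMap ζ (mirror m) = rotateFst ζ (tileMap ζ m) := by
  have ht := IsStarGauge.norm.div_nonneg (isStarGauge_wedgeGauge hζ) m
  rw [tileMap, tileMap, ← wedgeMap_mirror ζ (mul_nonneg ht hb) (mul_nonneg ht hu)]
  simp only [radialRescale, norm_mirror, wedgeGauge_mirror, mirror_smul]

theorem wedgeMap_injOn {n : ℕ} (hn : 3 ≤ n) :
    InjOn (wedgeMap (stepAngle n)) {m | 0 ≤ m.2.2.2 ∨ m.2.1 ≤ 0} := by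
  have hζ := stepAngle_im_pos hn
  have key : ∀ m : ℝ × ℝ × ℝ × ℝ, m.2.2.2 < 0 → m.2.1 ≤ 0 →
      wedgeMap (stepAngle n) m = rotateFst (stepAngle n) (wedgeMap (stepAngle n) (mirror m)) :=
    fun m hb hu => by
      rw [← wedgeMap_mirror _ (neg_nonneg.2 hb.le) (neg_nonneg.2 hu), mirror_mirror]
  have mixed : ∀ m m' : ℝ × ℝ × ℝ × ℝ, 0 ≤ m.2.2.2 → m'.2.2.2 < 0 → m'.2.1 ≤ 0 →
      wedgeMap (stepAngle n) m ≠ wedgeMap (stepAngle n) m' := by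
    intro m m' hb hb' hu' h
    rw [key m' hb' hu'] at h
    have h1 := (wedgeMap_stepAngle_unique hn (k := 1) (i := 0) (m := mirror m') (m' := m)
      (neg_pos.2 hb') hb (by rw [pow_one, pow_zero, rotateFst_one, h])).1
    rw [pow_one, pow_zero] at h1
    simp [h1] at hζ
  intro m hm m' hm' h
  rcases le_or_gt 0 m.2.2.2 with hb | hb <;> rcases le_or_gt 0 m'.2.2.2 with hb' | hb'
  · exact wedgeMap_injOn_nonneg hζ hb hb' h
  · exact (mixed m m' hb hb' (hm'.resolve_left hb'.not_ge) h).elim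
  · exact (mixed m' m hb' hb (hm.resolve_left hb.not_ge) h.symm).elim
  · rw [key m hb (hm.resolve_left hb.not_ge), key m' hb' (hm'.resolve_left hb'.not_ge)] at h
    rw [← mirror_mirror m, ← mirror_mirror m', wedgeMap_injOn_nonneg hζ (m := mirror m)
      (m' := mirror m') (neg_nonneg.2 hb.le) (neg_nonneg.2 hb'.le) ((rotateFst _).injective h)]

theorem tileMap_injOn {n : ℕ} (hn : 3 ≤ n) :
    InjOn (tileMap (stepAngle n)) {m | 0 ≤ m.2.2.2 ∨ m.2.1 ≤ 0} := by
  have hζ := stepAngle_im_pos hn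
  exact fun m hm m' hm' h => IsStarGauge.norm.radialRescale_injective (isStarGauge_wedgeGauge hζ)
    (wedgeMap_injOn hn (nonneg_or_radialRescale hζ hm) (nonneg_or_radialRescale hζ hm') h)

theorem tileMap_unique {n : ℕ} (hn : 3 ≤ n) {m m' : ℝ × ℝ × ℝ × ℝ} {k i : ℕ}
    (hb : 0 < m.2.2.2) (hb' : 0 ≤ m'.2.2.2)
    (h : rotateFst (stepAngle n ^ k) (tileMap (stepAngle n) m) =
      rotateFst (stepAngle n ^ i) (tileMap (stepAngle n) m')) :
    stepAngle n ^ k = stepAngle n ^ i ∧ m = m' := by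
  have hγ := isStarGauge_wedgeGauge (stepAngle_im_pos hn)
  have hm : m ≠ 0 := by
    rintro rfl
    exact lt_irrefl _ hb
  obtain ⟨h1, h2⟩ := wedgeMap_stepAngle_unique hn
    (mul_pos (div_pos (IsStarGauge.norm.pos m hm) (hγ.pos m hm)) hb)
    (mul_nonneg (IsStarGauge.norm.div_nonneg hγ m') hb') h
  exact ⟨h1, IsStarGauge.norm.radialRescale_injective hγ h2⟩

theorem exists_tileMap_eq {n : ℕ} (hn : 3 ≤ n) (y : WithLp 2 (ℂ × ℂ)) :
    ∃ (k : ℕ) (m : ℝ × ℝ × ℝ × ℝ), 0 ≤ m.2.2.2 ∧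
      rotateFst (stepAngle n ^ k) (tileMap (stepAngle n) m) = y := by
  obtain ⟨z, w⟩ := y
  have hγ := isStarGauge_wedgeGauge (stepAngle_im_pos hn)
  obtain ⟨k, x, y, hx, hy, h⟩ := exists_sector hn z
  have hb : 0 ≤ min x y := le_min hx hy
  refine ⟨k, radialRescale (wedgeGauge (stepAngle n)) (fun w => ‖w‖)
    (w.re, x - y, w.im, min x y), mul_nonneg (hγ.div_nonneg IsStarGauge.norm _) hb, ?_⟩
  have e1 : min x y + max (x - y) 0 = x := by
    rcases le_total x y with h | h
    · rw [min_eq_left h, max_eq_right (by linarith), add_zero]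
    · rw [min_eq_right h, max_eq_left (by linarith)]; ring
  have e2 : min x y + max (-(x - y)) 0 = y := by
    rcases le_total x y with h | h
    · rw [min_eq_left h, max_eq_left (by linarith)]; ring
    · rw [min_eq_right h, max_eq_right (by linarith), add_zero]
  rw [tileMap, hγ.radialRescale_radialRescale IsStarGauge.norm, wedgeMap_of_nonneg _ hb, e1, e2,
    rotateFst_apply, Circle.coe_pow, coe_stepAngle, ← h, Complex.re_add_im]

/-- The `k`-th tile of the unit ball of `ℂ × ℂ`. -/
def ballTile (n k : ℕ) : Set (WithLp 2 (ℂ × ℂ)) :=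
  rotateFst (stepAngle n ^ k) '' (tileMap (stepAngle n) '' modelTile)

theorem ballTile_mod {n : ℕ} (hn : n ≠ 0) (k : ℕ) : ballTile n (k % n) = ballTile n k := by
  rw [ballTile, ballTile, ← pow_eq_pow_mod k (isPrimitiveRoot_stepAngle hn).pow_eq_one]

theorem ballTile_subset {n : ℕ} (hn : 3 ≤ n) (k : ℕ) :
    ballTile n k ⊆ Metric.closedBall 0 1 := by
  rintro _ ⟨_, ⟨m, hm, rfl⟩, rfl⟩
  rw [mem_closedBall_zero_iff, LinearIsometryEquiv.norm_map,
    norm_tileMap (stepAngle_im_pos hn) (modelTile_nonneg_or hm)]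
  exact modelTile_norm_le hm

theorem exists_mem_ballTile {n : ℕ} (hn : 3 ≤ n) {y : WithLp 2 (ℂ × ℂ)}
    (hy : y ∈ Metric.closedBall 0 1) : ∃ k, y ∈ ballTile n k := by
  have hζ := stepAngle_im_pos hn
  obtain ⟨k, m, hb, rfl⟩ := exists_tileMap_eq hn y
  rw [mem_closedBall_zero_iff, LinearIsometryEquiv.norm_map, norm_tileMap hζ (.inl hb)] at hy
  simp only [Prod.norm_def, Real.norm_eq_abs, max_le_iff] at hy
  obtain ⟨h1, h2, h3, h4⟩ := hy
  rcases le_or_gt (bump m.1 m.2.1 m.2.2.1) m.2.2.2 with h | h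
  · have := dent_nonneg m.1 m.2.1 m.2.2.1
    exact ⟨k, _, ⟨m, ⟨⟨h1, h2, h3⟩, by linarith, (abs_le.1 h4).2⟩, rfl⟩, rfl⟩
  · have hu : 0 < m.2.1 := by
      by_contra hu
      rw [bump_eq_zero (not_lt.1 hu)] at h
      exact h.not_ge hb
    have hmem : mirror m ∈ modelTile := by
      refine ⟨⟨h1, (abs_neg _).trans_le h2, h3⟩, ?_, ?_⟩
      · simp only [mirror, dent, neg_neg]
        rw [bump_eq_zero (neg_nonpos.2 hu.le), zero_sub, neg_le_neg_iff]
        exact le_min (abs_le.1 h4).2 h.le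
      · simp only [mirror]
        linarith
    refine ⟨k + (n - 1), _, ⟨_, hmem, rfl⟩, ?_⟩
    rw [tileMap_mirror hζ hb hu.le, ← rotateFst_mul, ← pow_succ, add_assoc,
      Nat.sub_add_cancel (by omega), pow_add,
      (isPrimitiveRoot_stepAngle (n := n) (by omega)).pow_eq_one, mul_one]

theorem iUnion_ballTile {n : ℕ} (hn : 3 ≤ n) :
    ⋃ i : Fin n, ballTile n i = Metric.closedBall 0 1 := by
  refine subset_antisymm (iUnion_subset fun i => ballTile_subset hn i) fun y hy => ?_
  obtain ⟨k, hk⟩ := exists_mem_ballTile hn hy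
  rw [← ballTile_mod (by omega)] at hk
  exact mem_iUnion.2 ⟨⟨k % n, Nat.mod_lt _ (by omega)⟩, hk⟩

theorem mem_ballTile_cases {n : ℕ} (hn : 3 ≤ n) {m : ℝ × ℝ × ℝ × ℝ} (hb : 0 < m.2.2.2) {k i : ℕ}
    (h : rotateFst (stepAngle n ^ k) (tileMap (stepAngle n) m) ∈ ballTile n i) :
    (stepAngle n ^ k = stepAngle n ^ i ∧ bump m.1 m.2.1 m.2.2.1 ≤ m.2.2.2) ∨
      (stepAngle n ^ k = stepAngle n ^ (i + 1) ∧ m.2.2.2 ≤ bump m.1 m.2.1 m.2.2.1) := by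
  obtain ⟨_, ⟨m', hm', rfl⟩, h⟩ := h
  rcases le_or_gt 0 m'.2.2.2 with hb' | hb'
  · obtain ⟨h1, rfl⟩ := tileMap_unique hn hb hb' h.symm
    refine .inl ⟨h1, ?_⟩
    rcases le_total m.2.1 0 with hu | hu
    · rwa [bump_eq_zero hu]
    · have := hm'.2.1
      rwa [dent_eq_zero hu, sub_zero] at this
  · have hu := (modelTile_nonneg_or hm').resolve_left hb'.not_ge
    have hb'' : 0 ≤ (mirror m').2.2.2 := neg_nonneg.2 hb'.le
    rw [← mirror_mirror m', tileMap_mirror (stepAngle_im_pos hn) hb'' (neg_nonneg.2 hu),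
      ← rotateFst_mul, ← pow_succ] at h
    obtain ⟨h1, rfl⟩ := tileMap_unique hn hb hb'' h.symm
    refine .inr ⟨h1, ?_⟩
    have h2 := hm'.2.1
    rw [bump_eq_zero hu] at h2
    have h3 : dent m'.1 m'.2.1 m'.2.2.1 ≤ bump m'.1 (-m'.2.1) m'.2.2.1 := min_le_right _ _
    simp only [mirror]
    linarith

theorem interior_ballTile_inter {n : ℕ} (hn : 3 ≤ n) {i j : ℕ} (hi : i < n) (hj : j < n)
    (hij : i ≠ j) : interior (ballTile n i) ∩ interior (ballTile n j) = ∅ := by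
  rw [eq_empty_iff_forall_notMem]
  intro y hy
  obtain ⟨k, m, hb, rfl⟩ := exists_tileMap_eq hn y
  have hroot := isPrimitiveRoot_stepAngle (n := n) (by omega)
  have hc : Continuous fun b : ℝ =>
      rotateFst (stepAngle n ^ k) (tileMap (stepAngle n) (m.1, m.2.1, m.2.2.1, b)) :=
    (rotateFst _).continuous.comp
      ((continuous_tileMap (stepAngle_im_pos hn)).comp (by fun_prop))
  have hev := (hc.tendsto m.2.2.2).eventually
    ((isOpen_interior.inter isOpen_interior).mem_nhds hy)
  have hev' := (hev.filter_mono nhdsWithin_le_nhds).and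
    (self_mem_nhdsWithin (a := m.2.2.2) (s := Ioi m.2.2.2))
  have hne : ∀ᶠ b in nhdsWithin m.2.2.2 (Ioi m.2.2.2), b ≠ bump m.1 m.2.1 m.2.2.1 := by
    rcases eq_or_ne m.2.2.2 (bump m.1 m.2.1 m.2.2.1) with h | h
    · rw [← h]
      exact Filter.eventually_of_mem self_mem_nhdsWithin fun b hb => ne_of_gt hb
    · exact mem_nhdsWithin_of_mem_nhds (isOpen_ne.mem_nhds h)
  obtain ⟨b, ⟨⟨h1, h2⟩, h3⟩, h4⟩ := (hev'.and hne).exists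
  have hb' : 0 < b := hb.trans_lt h3
  have h5 := mem_ballTile_cases hn (m := (m.1, m.2.1, m.2.2.1, b)) hb' (interior_subset h1)
  have h6 := mem_ballTile_cases hn (m := (m.1, m.2.1, m.2.2.1, b)) hb' (interior_subset h2)
  dsimp only at h5 h6
  rcases h5 with ⟨h5, h7⟩ | ⟨h5, h7⟩ <;> rcases h6 with ⟨h6, h8⟩ | ⟨h6, h8⟩
  · exact hij (hroot.pow_inj hi hj (h5.symm.trans h6))
  · exact h4 (le_antisymm h8 h7)
  · exact h4 (le_antisymm h7 h8)
  · rw [h5, pow_succ, pow_succ, mul_left_inj] at h6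
    exact hij (hroot.pow_inj hi hj h6)

/-- A parametrization of the `k`-th tile by `T² × D²`. -/
noncomputable def tileParam (n k : ℕ) (p : TorusTimesDisk) : WithLp 2 (ℂ × ℂ) :=
  rotateFst (stepAngle n ^ k) (tileMap (stepAngle n) (pushDown (solidParam p)))

theorem continuous_tileParam {n : ℕ} (hn : 3 ≤ n) (k : ℕ) : Continuous (tileParam n k) :=
  (rotateFst _).continuous.comp ((continuous_tileMap (stepAngle_im_pos hn)).comp
    (continuous_pushDown.comp continuous_solidParam))

theorem range_tileParam (n k : ℕ) : range (tileParam n k) = ballTile n k := by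
  rw [ballTile, ← pushDown_image, ← range_solidParam, ← range_comp, ← range_comp, ← range_comp]
  rfl

theorem tileParam_injective {n : ℕ} (hn : 3 ≤ n) (k : ℕ) :
    Function.Injective (tileParam n k) := by
  have hmem : ∀ p, pushDown (solidParam p) ∈ {m | 0 ≤ m.2.2.2 ∨ m.2.1 ≤ 0} := fun p => by
    refine modelTile_nonneg_or ?_
    rw [← pushDown_image, ← range_solidParam]
    exact mem_image_of_mem _ (mem_range_self p)
  exact fun p q h => solidParam_injective (pushDown_injective
    (tileMap_injOn hn (hmem p) (hmem q) ((rotateFst _).injective h)))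

instance : ConnectedSpace TorusTimesDisk := by
  have h1 : ConnectedSpace (Metric.sphere (0 : EuclideanSpace ℝ (Fin 2)) 1) :=
    isConnected_iff_connectedSpace.1 (isConnected_sphere
      (by rw [rank_eq_card_basis (EuclideanSpace.basisFun (Fin 2) ℝ).toBasis]; simp) 0 zero_le_one)
  have h2 : ConnectedSpace (Metric.closedBall (0 : EuclideanSpace ℝ (Fin 2)) 1) :=
    isConnected_iff_connectedSpace.1
      ((convex_closedBall _ _).isConnected (Metric.nonempty_closedBall.2 zero_le_one))
  infer_instance

theorem isCompact_ballTile {n : ℕ} (hn : 3 ≤ n) (k : ℕ) : IsCompact (ballTile n k) := by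
  rw [← range_tileParam]
  exact isCompact_range (continuous_tileParam hn k)

theorem isConnected_ballTile {n : ℕ} (hn : 3 ≤ n) (k : ℕ) : IsConnected (ballTile n k) := by
  rw [← range_tileParam]
  exact isConnected_range (continuous_tileParam hn k)

theorem nonempty_ballTile_homeomorph {n : ℕ} (hn : 3 ≤ n) (k : ℕ) :
    Nonempty (ballTile n k ≃ₜ TorusTimesDisk) := by
  rw [← range_tileParam]
  exact ⟨((continuous_tileParam hn k).isClosedEmbedding
    (tileParam_injective hn k)).isEmbedding.toHomeomorph.symm⟩

theorem exists_isometryEquiv_ballTile (n i j : ℕ) :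
    ∃ f : WithLp 2 (ℂ × ℂ) ≃ᵢ WithLp 2 (ℂ × ℂ), f '' ballTile n i = ballTile n j := by
  refine ⟨((rotateFst (stepAngle n ^ i)).symm.trans
    (rotateFst (stepAngle n ^ j))).toIsometryEquiv, ?_⟩
  rw [ballTile, ballTile, image_image]
  simp

theorem nonempty_interior_ballTile {n : ℕ} (hn : 3 ≤ n) (k : ℕ) :
    (interior (ballTile n k)).Nonempty := by
  have hex : ∃ i : Fin n, (interior (ballTile n i)).Nonempty := by
    by_contra! h
    have hd : Dense (⋂ i : Fin n, (ballTile n i)ᶜ) :=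
      dense_iInter_of_isOpen (fun i => (isCompact_ballTile hn i).isClosed.isOpen_compl)
        fun i => interior_eq_empty_iff_dense_compl.1 (h i)
    rw [← compl_iUnion, iUnion_ballTile hn, ← interior_eq_empty_iff_dense_compl] at hd
    have h0 : (0 : WithLp 2 (ℂ × ℂ)) ∈ interior (Metric.closedBall 0 1) :=
      Metric.ball_subset_interior_closedBall (Metric.mem_ball_self one_pos)
    rw [hd] at h0
    exact h0
  obtain ⟨i, hi⟩ := hex
  obtain ⟨f, hf⟩ := exists_isometryEquiv_ballTile n i k
  rw [← hf, ← f.coe_toHomeomorph, ← f.toHomeomorph.image_interior]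
  exact hi.image _

/-- **4D Tiling Theorem (torus case).** For every `n ≥ 3`, the closed unit ball
`B⁴ ⊆ ℝ⁴` admits a monohedral tiling by `n` tiles, each homeomorphic to `(S¹ × S¹) × D²`. -/
theorem unitBall4_monohedral_tiling_torus_times_disk (n : ℕ) (hn : 3 ≤ n) :
    ∃ T : Fin n → Set (EuclideanSpace ℝ (Fin 4)),
      (⋃ i, T i) = Metric.closedBall (0 : EuclideanSpace ℝ (Fin 4)) 1 ∧
      (∀ i, IsCompact (T i)) ∧
      (∀ i, IsConnected (T i)) ∧
      (∀ i, (interior (T i)).Nonempty) ∧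
      (∀ i j, i ≠ j → interior (T i) ∩ interior (T j) = ∅) ∧
      (∀ i j, ∃ f : EuclideanSpace ℝ (Fin 4) ≃ᵢ EuclideanSpace ℝ (Fin 4),
        f '' (T i) = T j) ∧
      (∀ i, Nonempty ((T i) ≃ₜ
        ((Metric.sphere (0 : EuclideanSpace ℝ (Fin 2)) 1 ×
          Metric.sphere (0 : EuclideanSpace ℝ (Fin 2)) 1) ×
          Metric.closedBall (0 : EuclideanSpace ℝ (Fin 2)) 1))) := by
  have hrank : Module.finrank ℝ (WithLp 2 (ℂ × ℂ)) = 4 := by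
    rw [(WithLp.linearEquiv 2 ℝ (ℂ × ℂ)).finrank_eq]
    simp
  let e : WithLp 2 (ℂ × ℂ) ≃ₗᵢ[ℝ] EuclideanSpace ℝ (Fin 4) :=
    ((stdOrthonormalBasis ℝ _).reindex (finCongr hrank)).repr
  refine ⟨fun i => e '' ballTile n i, ?_, fun i => (isCompact_ballTile hn i).image e.continuous,
    fun i => (isConnected_ballTile hn i).image e e.continuous.continuousOn, fun i => ?_,
    fun i j hij => ?_, fun i j => ?_, fun i => ?_⟩
  · rw [← image_iUnion, iUnion_ballTile hn, e.image_closedBall, map_zero]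
  · rw [← e.coe_toHomeomorph, ← e.toHomeomorph.image_interior]
    exact (nonempty_interior_ballTile hn i).image _
  · rw [← e.coe_toHomeomorph, ← e.toHomeomorph.image_interior, ← e.toHomeomorph.image_interior,
      ← image_inter e.toHomeomorph.injective, interior_ballTile_inter hn i.2 j.2
        (Fin.val_ne_of_ne hij), image_empty]
  · obtain ⟨f, hf⟩ := exists_isometryEquiv_ballTile n i j
    refine ⟨(e.symm.toIsometryEquiv.trans f).trans e.toIsometryEquiv, ?_⟩
    simp only [← hf, image_image]
    simp
  · obtain ⟨g⟩ := nonempty_ballTile_homeomorph hn i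
    exact ⟨(e.toHomeomorph.image (ballTile n i)).symm.trans g⟩
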